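/- Let n ≥ 2, let H ≥ 1 and ε > 0 be real numbers, and let 𝒩(ε,H) be the number of points of ℙ(M_n(ℚ)) of Northcott–Schmidt height at most H that belong to Ŝ(ε). Then |𝒩(ε,H) − Vol(R(ε,H))/(2ζ(n²))| ≤ L(ε,n)·H^{n²−1} + H/2, where L(ε,n) := T_n·𝔖^{(n²)}/(2ζ(n²−1)) + Vol(R(ε,1))/2, T_n := (2·max{4,n})^{2n⁴+4n²}, and ζ is the Riemann zeta function. -/

import Mathlib

open scoped ENNReal
open MeasureTheory

noncomputable section

instance {n : ℕ} : MeasureSpace (Matrix (Fin n) (Fin n) ℝ) :=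
  inferInstanceAs (MeasureSpace (Fin n → Fin n → ℝ))

/-- Frobenius norm of a real matrix. -/
def frobNorm {n : ℕ} (M : Matrix (Fin n) (Fin n) ℝ) : ℝ :=
  Real.sqrt (∑ i, ∑ j, (M i j) ^ 2)

/-- Frobenius (Euclidean) inner product of matrices. -/
def frobInner {n : ℕ} (A B : Matrix (Fin n) (Fin n) ℝ) : ℝ := ∑ i, ∑ j, A i j * B i j

/-- The Fubini–Study distance, expressed on representatives. -/
def dFS {n : ℕ} (A B : Matrix (Fin n) (Fin n) ℝ) : ℝ :=
  Real.sin (Real.arccos (|frobInner A B| / (frobNorm A * frobNorm B)))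

/-- Fubini–Study distance from (the projective class of) `M` to the projective variety
`Ŝ = π(S \ {0})` of singular matrices. -/
def rhoSing {n : ℕ} (M : Matrix (Fin n) (Fin n) ℝ) : ℝ :=
  sInf {t : ℝ | ∃ S : Matrix (Fin n) (Fin n) ℝ, S ≠ 0 ∧ ¬ IsUnit S.det ∧ t = dFS M S}

/-- `R(ε,H) = B(0,H) ∩ (π⁻¹(Ŝ(ε)) ∪ {0})`. -/
def Rset (n : ℕ) (ε H : ℝ) : Set (Matrix (Fin n) (Fin n) ℝ) :=
  {M | frobNorm M ≤ H} ∩ {M | M = 0 ∨ rhoSing M ≤ ε}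

/-- The point of `ℙ(M_n(ℚ))` has Northcott–Schmidt height at most `H`. -/
def heightLE {n : ℕ} (P : Projectivization ℚ (Matrix (Fin n) (Fin n) ℚ)) (H : ℝ) : Prop :=
  ∃ (A : Matrix (Fin n) (Fin n) ℤ) (h0 : (A.map (Int.cast : ℤ → ℚ)) ≠ 0),
    (Finset.univ.gcd (fun p : Fin n × Fin n => A p.1 p.2) = 1) ∧
    P = Projectivization.mk ℚ (A.map (Int.cast : ℤ → ℚ)) h0 ∧
    frobNorm (A.map (Int.cast : ℤ → ℝ)) ≤ H

/-- A point of `ℙ(M_n(ℚ))` belongs to `Ŝ(ε)` : the Fubini–Study distance from (the real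
projective point defined by) a representative to `Ŝ` is at most `ε`. -/
def memShat {n : ℕ} (P : Projectivization ℚ (Matrix (Fin n) (Fin n) ℚ)) (ε : ℝ) : Prop :=
  rhoSing ((Projectivization.rep P).map (Rat.cast : ℚ → ℝ)) ≤ ε

/-- `K_ℓ = π^{ℓ/2}/Γ(ℓ/2 + 1)`, the volume of the unit ball in `ℝ^ℓ`. -/
def Kvol (ℓ : ℕ) : ℝ := Real.pi ^ ((ℓ : ℝ) / 2) / Real.Gamma ((ℓ : ℝ) / 2 + 1)

/-- `𝔖^{(m)} = Σ_{ℓ=0}^{m-1} C(m,ℓ)·K_ℓ`. -/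
def Sfrak (m : ℕ) : ℝ := ∑ ℓ ∈ Finset.range m, (m.choose ℓ : ℝ) * Kvol ℓ

/-- `T_n = (2·max{4,n})^{2n⁴+4n²}`. -/
def Tconst (n : ℕ) : ℝ := ((2 * max 4 n : ℕ) : ℝ) ^ (2 * n ^ 4 + 4 * n ^ 2)

/-- `ζ(m) = Σ_{k≥1} 1/k^m`, the Riemann zeta function at a positive integer. -/
def zetaN (m : ℕ) : ℝ := ∑' k : ℕ, 1 / ((k : ℝ) + 1) ^ m

theorem abs_measureReal_prod_sub_le {α β : Type*} [MeasurableSpace α] [MeasurableSpace β]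
    (μ μ' : Measure α) (ν ν' : Measure β) [IsFiniteMeasure μ] [IsFiniteMeasure μ']
    [IsFiniteMeasure ν] [IsFiniteMeasure ν'] {R : Set (α × β)} (hR : MeasurableSet R) {a b : ℝ}
    (ha : ∀ x, |ν.real (Prod.mk x ⁻¹' R) - ν'.real (Prod.mk x ⁻¹' R)| ≤ a)
    (hb : ∀ y, |μ.real ((fun x => (x, y)) ⁻¹' R) - μ'.real ((fun x => (x, y)) ⁻¹' R)| ≤ b) :
    |(μ.prod ν).real R - (μ'.prod ν').real R| ≤ a * μ.real Set.univ + b * ν'.real Set.univ := by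
  have fst_form (ρ : Measure β) [IsFiniteMeasure ρ] :
      Integrable (fun x => ρ.real (Prod.mk x ⁻¹' R)) μ ∧
        (μ.prod ρ).real R = ∫ x, ρ.real (Prod.mk x ⁻¹' R) ∂μ := by
    refine ⟨Measure.integrable_measure_prodMk_left hR (measure_ne_top _ _), ?_⟩
    simp only [Measure.real]
    rw [integral_toReal (measurable_measure_prodMk_left hR).aemeasurable
      (Filter.Eventually.of_forall fun x => measure_lt_top _ _), Measure.prod_apply hR]
  have snd_form (ρ : Measure α) [IsFiniteMeasure ρ] :
      Integrable (fun y => ρ.real ((fun x => (x, y)) ⁻¹' R)) ν' ∧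
        (ρ.prod ν').real R = ∫ y, ρ.real ((fun x => (x, y)) ⁻¹' R) ∂ν' := by
    have hm := measurable_measure_prodMk_right (μ := ρ) hR
    refine ⟨?_, ?_⟩
    · refine Integrable.of_bound (C := ρ.real Set.univ) hm.ennreal_toReal.aestronglyMeasurable
        (Filter.Eventually.of_forall fun y => ?_)
      rw [Real.norm_of_nonneg measureReal_nonneg]
      exact measureReal_mono (Set.subset_univ _)
    · simp only [Measure.real]
      rw [integral_toReal hm.aemeasurable
        (Filter.Eventually.of_forall fun x => measure_lt_top _ _), Measure.prod_apply_symm hR]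
  have h1 : |(μ.prod ν).real R - (μ.prod ν').real R| ≤ a * μ.real Set.univ := by
    rw [(fst_form ν).2, (fst_form ν').2, ← integral_sub (fst_form ν).1 (fst_form ν').1,
      ← Real.norm_eq_abs]
    exact norm_integral_le_of_norm_le_const (Filter.Eventually.of_forall ha)
  have h2 : |(μ.prod ν').real R - (μ'.prod ν').real R| ≤ b * ν'.real Set.univ := by
    rw [(snd_form μ).2, (snd_form μ').2, ← integral_sub (snd_form μ).1 (snd_form μ').1,
      ← Real.norm_eq_abs]
    exact norm_integral_le_of_norm_le_const (Filter.Eventually.of_forall hb)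
  calc _ ≤ _ := abs_sub_le _ ((μ.prod ν').real R) _
    _ ≤ _ := add_le_add h1 h2

theorem abs_measureReal_pi_fin_sub_le (μ ν : Measure ℝ) [IsFiniteMeasure μ] [IsFiniteMeasure ν]
    {B h : ℝ} (hμ : μ.real Set.univ ≤ B) (hν : ν.real Set.univ ≤ B) (hh : 0 ≤ h) :
    ∀ (N : ℕ) {R : Set (Fin N → ℝ)}, MeasurableSet R →
      (∀ x i, |μ.real {s | Function.update x i s ∈ R} -
        ν.real {s | Function.update x i s ∈ R}| ≤ h) →
      |(Measure.pi fun _ => μ).real R - (Measure.pi fun _ => ν).real R| ≤ N * h * B ^ (N - 1) := by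
  intro N
  have hB : 0 ≤ B := measureReal_nonneg.trans hμ
  induction N with
  | zero =>
    intro R hR hline
    rw [Measure.pi_of_empty, Measure.pi_of_empty]
    simp
  | succ N ih =>
    intro R hR hline
    set e := MeasurableEquiv.piFinSuccAbove (fun _ : Fin (N + 1) => ℝ) 0
    have transfer (ρ : Measure ℝ) [IsFiniteMeasure ρ] : (Measure.pi fun _ => ρ).real R =
        (ρ.prod (Measure.pi fun _ : Fin N => ρ)).real (e.symm ⁻¹' R) := by
      have hp := (measurePreserving_piFinSuccAbove (fun _ : Fin (N + 1) => ρ) 0).symm e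
      rw [Measure.real, Measure.real, hp.measure_preimage_equiv]
    have he (x : ℝ) (y : Fin N → ℝ) : e.symm (x, y) = Fin.cons x y := by
      simp [e]
      rfl
    rw [transfer μ, transfer ν]
    refine (abs_measureReal_prod_sub_le μ ν _ _ (e.symm.measurable hR)
      (a := N * h * B ^ (N - 1)) (b := h) (fun x => ?_) (fun y => ?_)).trans ?_
    · refine ih (measurable_prodMk_left (e.symm.measurable hR)) fun y i => ?_
      convert hline (Fin.cons x y : Fin (N + 1) → ℝ) i.succ using 5 <;>
        simp [he, Fin.cons_update]
    · convert hline (Fin.cons 0 y : Fin (N + 1) → ℝ) 0 using 5 <;>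
        simp [he, Set.preimage]
    · have h2 : (Measure.pi fun _ : Fin N => ν).real Set.univ ≤ B ^ N := by
        rw [Measure.real, Measure.pi_univ]
        simp only [Finset.prod_const, Finset.card_univ, Fintype.card_fin, ENNReal.toReal_pow]
        exact pow_le_pow_left₀ measureReal_nonneg hν N
      calc _ ≤ N * h * B ^ (N - 1) * B + h * B ^ N := by gcongr
        _ = (N + 1 : ℕ) * h * B ^ (N + 1 - 1) := by
          rcases N with _ | N
          · simp
          · simp only [Nat.add_sub_cancel]
            push_cast
            ring

theorem abs_measureReal_pi_sub_le {ι : Type*} [Fintype ι] [DecidableEq ι] (μ ν : Measure ℝ)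
    [IsFiniteMeasure μ] [IsFiniteMeasure ν]
    {B h : ℝ} (hμ : μ.real Set.univ ≤ B) (hν : ν.real Set.univ ≤ B) (hh : 0 ≤ h)
    {R : Set (ι → ℝ)} (hR : MeasurableSet R)
    (hline : ∀ x i, |μ.real {s | Function.update x i s ∈ R} -
        ν.real {s | Function.update x i s ∈ R}| ≤ h) :
    |(Measure.pi fun _ => μ).real R - (Measure.pi fun _ => ν).real R| ≤
      Fintype.card ι * h * B ^ (Fintype.card ι - 1) := by
  set f := (Fintype.equivFin ι).symm
  set e := MeasurableEquiv.piCongrLeft (fun _ : ι => ℝ) f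
  have transfer (ρ : Measure ℝ) [IsFiniteMeasure ρ] : (Measure.pi fun _ => ρ).real R =
      (Measure.pi fun _ : Fin (Fintype.card ι) => ρ).real (e ⁻¹' R) := by
    have hp := measurePreserving_piCongrLeft (fun _ : ι => ρ) f
    rw [Measure.real, Measure.real, hp.measure_preimage_equiv]
  rw [transfer μ, transfer ν]
  refine abs_measureReal_pi_fin_sub_le μ ν hμ hν hh _ (e.measurable hR) fun x i => ?_
  have he (s : ℝ) : e (Function.update x i s) = Function.update (e x) (f i) s := by
    ext j
    obtain ⟨j, rfl⟩ := f.surjective j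
    simp only [e, MeasurableEquiv.coe_piCongrLeft]
    rw [Equiv.piCongrLeft_apply_apply]
    simp [Function.update_apply, Equiv.piCongrLeft_apply_apply]
  simpa [he] using hline (e x) (f i)

theorem IsPreconnected.inter_frontier_nonempty {X : Type*} [TopologicalSpace X] {s U : Set X}
    (hs : IsPreconnected s) (h : (s ∩ U).Nonempty) (h' : (s ∩ Uᶜ).Nonempty) :
    (s ∩ frontier U).Nonempty := by
  by_contra hne
  have hd : ∀ x ∈ s, x ∈ closure U → x ∈ interior U := fun x hx hc => by
    by_contra hi
    exact hne ⟨x, hx, hc, hi⟩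
  obtain ⟨x, hx, hxU⟩ := h
  obtain ⟨y, hy, hyU⟩ := h'
  obtain ⟨z, _, hz, hz'⟩ := hs (interior U) (closure U)ᶜ isOpen_interior
    isClosed_closure.isOpen_compl (fun w hw => or_iff_not_imp_right.2 fun h => hd w hw (not_not.1 h))
    ⟨x, hx, hd x hx (subset_closure hxU)⟩
    ⟨y, hy, fun h => hyU (interior_subset (hd y hy h))⟩
  exact hz' (subset_closure (interior_subset hz))

/-- The counting measure of the integers in `[-T, T]`. -/
def intMeasure (T : ℕ) : Measure ℝ :=
  ∑ k ∈ Finset.Icc (-T : ℤ) T, Measure.dirac (k : ℝ)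

instance (T : ℕ) : IsFiniteMeasure (intMeasure T) := by
  unfold intMeasure; infer_instance

theorem intMeasure_real_apply (T : ℕ) {U : Set ℝ} (hU : MeasurableSet U) :
    (intMeasure T).real U = ∑ k ∈ Finset.Icc (-T : ℤ) T, U.indicator 1 (k : ℝ) := by
  rw [intMeasure, Measure.real, Measure.finsetSum_apply, ENNReal.toReal_sum]
  · refine Finset.sum_congr rfl fun k _ => ?_
    rw [Measure.dirac_apply' _ hU]
    by_cases hk : (k : ℝ) ∈ U <;> simp [hk]
  · exact fun k _ => measure_ne_top _ _

theorem intMeasure_real_univ (T : ℕ) : (intMeasure T).real Set.univ = 2 * T + 1 := by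
  rw [intMeasure_real_apply T MeasurableSet.univ]
  simp only [Set.indicator_univ, Pi.one_apply, Finset.sum_const, Int.card_Icc, nsmul_eq_mul, mul_one]
  have : ((T : ℤ) + 1 - -T).toNat = 2 * T + 1 := by omega
  rw [this]; push_cast; ring

theorem abs_intMeasure_sub_volume_le (T : ℕ) {U : Set ℝ} (hU : MeasurableSet U)
    (hUT : U ⊆ Set.Icc (-T : ℝ) T) (F : Finset ℝ) (hF : frontier U ⊆ F) :
    |(intMeasure T).real U - (volume.restrict (Set.Icc (-T : ℝ) T)).real U| ≤ F.card := by
  have hcell (k : ℤ) : (volume (U ∩ Set.Ico (k : ℝ) (k + 1))).toReal ≤ 1 := by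
    refine ENNReal.toReal_le_of_le_ofReal zero_le_one
      ((measure_mono Set.inter_subset_right).trans ?_)
    simp
  have hvol : (volume.restrict (Set.Icc (-T : ℝ) T)).real U =
      ∑ k ∈ Finset.Icc (-T : ℤ) T, (volume (U ∩ Set.Ico (k : ℝ) (k + 1))).toReal := by
    rw [Measure.real, Measure.restrict_apply hU, Set.inter_eq_left.2 hUT, ← ENNReal.toReal_sum]
    · rw [← measure_biUnion_finset]
      · congr 2
        ext x
        simp only [Set.mem_iUnion, Set.mem_inter_iff, Finset.mem_Icc, Set.mem_Ico, exists_prop]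
        refine ⟨fun hx => ⟨⌊x⌋, ⟨?_, ?_⟩, hx, Int.floor_le x, Int.lt_floor_add_one x⟩,
          fun ⟨k, _, hx, _⟩ => hx⟩
        · exact Int.le_floor.2 (by simpa using (hUT hx).1)
        · exact_mod_cast (Int.floor_le x).trans (hUT hx).2
      · intro i _ j _ hij
        refine Set.disjoint_left.2 fun x hx hy => hij ?_
        rw [← Int.floor_eq_iff.2 hx.2, ← Int.floor_eq_iff.2 hy.2]
      · exact fun k _ => hU.inter measurableSet_Ico
    · exact fun k _ => ((measure_mono Set.inter_subset_right).trans_lt (by simp)).ne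
  have hterm (k : ℤ) : |U.indicator (1 : ℝ → ℝ) k -
      (volume (U ∩ Set.Ico (k : ℝ) (k + 1))).toReal| ≤ if k ∈ F.image Int.floor then 1 else 0 := by
    split_ifs with hk
    · have h0 : 0 ≤ (volume (U ∩ Set.Ico (k : ℝ) (k + 1))).toReal := ENNReal.toReal_nonneg
      have h1 := hcell k
      by_cases hkU : (k : ℝ) ∈ U <;> simp only [hkU, Set.indicator_of_mem,
        Set.indicator_of_notMem, not_false_eq_true, Pi.one_apply] <;>
        rw [abs_le] <;> constructor <;> linarith
    · have hk' : ¬ (Set.Ico (k : ℝ) (k + 1) ∩ frontier U).Nonempty := by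
        rintro ⟨x, hx, hxU⟩
        exact hk (Finset.mem_image.2 ⟨x, hF hxU, Int.floor_eq_iff.2 hx⟩)
      have hkmem : (k : ℝ) ∈ Set.Ico (k : ℝ) (k + 1) := by simp
      by_cases hkU : (k : ℝ) ∈ U
      · have hsub : Set.Ico (k : ℝ) (k + 1) ⊆ U := by
          by_contra hsub
          exact hk' (isPreconnected_Ico.inter_frontier_nonempty ⟨k, hkmem, hkU⟩
            (by obtain ⟨x, hx, hxU⟩ := Set.not_subset.1 hsub; exact ⟨x, hx, hxU⟩))
        rw [Set.inter_eq_right.2 hsub]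
        simp [hkU]
      · have hsub : U ∩ Set.Ico (k : ℝ) (k + 1) = ∅ := by
          by_contra hsub
          obtain ⟨x, hxU, hx⟩ := Set.nonempty_iff_ne_empty.2 hsub
          exact hk' (isPreconnected_Ico.inter_frontier_nonempty ⟨x, hx, hxU⟩ ⟨k, hkmem, hkU⟩)
        rw [hsub]
        simp [hkU]
  rw [intMeasure_real_apply T hU, hvol, ← Finset.sum_sub_distrib]
  calc _ ≤ ∑ k ∈ Finset.Icc (-T : ℤ) T, |_| := Finset.abs_sum_le_sum_abs _ _
    _ ≤ ∑ k ∈ Finset.Icc (-T : ℤ) T, if k ∈ F.image Int.floor then (1 : ℝ) else 0 :=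
      Finset.sum_le_sum fun k _ => hterm k
    _ = ((Finset.Icc (-T : ℤ) T).filter (· ∈ F.image Int.floor)).card := by simp
    _ ≤ (F.image Int.floor).card := by
      exact_mod_cast Finset.card_le_card fun k hk => (Finset.mem_filter.1 hk).2
    _ ≤ F.card := by exact_mod_cast Finset.card_image_le

theorem pi_intMeasure_real {ι : Type*} [Fintype ι] [DecidableEq ι] (T : ℕ) {R : Set (ι → ℝ)}
    (hRT : ∀ x ∈ R, ∀ i, |x i| ≤ T) :
    (Measure.pi fun _ : ι => intMeasure T).real R =
      Set.ncard {z : ι → ℤ | (fun i => (z i : ℝ)) ∈ R} := by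
  classical
  set μ := Measure.pi fun _ : ι => intMeasure T
  set c : (ι → ℤ) → (ι → ℝ) := fun z i => (z i : ℝ)
  have hc : Function.Injective c := fun z w h => funext fun i => by
    have : (z i : ℝ) = w i := congrFun h i
    exact_mod_cast this
  set Z : Finset (ι → ℤ) := Fintype.piFinset fun _ => Finset.Icc (-T : ℤ) T
  have hsing (z : ι → ℤ) (hz : z ∈ Z) : μ.real {c z} = 1 := by
    rw [Measure.real, Measure.pi_singleton, ENNReal.toReal_prod]
    refine Finset.prod_eq_one fun i _ => ?_
    change (intMeasure T).real _ = 1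
    rw [intMeasure_real_apply T (measurableSet_singleton _),
      Finset.sum_eq_single_of_mem (z i) (Fintype.mem_piFinset.1 hz i)]
    · simp [c]
    · intro k _ hk
      exact Set.indicator_of_notMem (by simpa [c] using hk) _
  have hfin (A : Finset (ι → ℤ)) (hA : A ⊆ Z) : μ.real (c '' A) = A.card := by
    have : c '' A = ⋃ z ∈ A, {c z} := by ext; simp [eq_comm]
    rw [this, measureReal_biUnion_finset]
    · rw [Finset.sum_congr rfl fun z hz => hsing z (hA hz)]
      simp
    · intro z _ w _ hzw
      simpa using hc.ne hzw
    · exact fun z _ => measurableSet_singleton _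
  have hZ : μ (c '' Z)ᶜ = 0 := by
    have hm : MeasurableSet (c '' (Z : Set (ι → ℤ))) :=
      (Z.finite_toSet.image c).measurableSet
    have h1 := measureReal_add_measureReal_compl (μ := μ) hm
    rw [hfin Z subset_rfl] at h1
    have h2 : μ.real Set.univ = Z.card := by
      rw [Measure.real, Measure.pi_univ, ENNReal.toReal_prod]
      change ∏ i : ι, (intMeasure T).real Set.univ = _
      rw [intMeasure_real_univ, Fintype.card_piFinset]
      simp only [Finset.prod_const, Int.card_Icc]
      have : ((T : ℤ) + 1 - -T).toNat = 2 * T + 1 := by omega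
      rw [this]; push_cast; rfl
    exact (measureReal_eq_zero_iff (measure_ne_top _ _)).1 (by linarith)
  have hset : {z : ι → ℤ | c z ∈ R} = ((Z.filter fun z => c z ∈ R : Finset _) : Set (ι → ℤ)) := by
    ext z
    simp only [Set.mem_ofPred_eq, Finset.coe_filter, iff_and_self]
    refine fun hz => Fintype.mem_piFinset.2 fun i => ?_
    have : -(T : ℝ) ≤ z i ∧ (z i : ℝ) ≤ T := abs_le.1 (hRT _ hz i)
    exact Finset.mem_Icc.2 ⟨by exact_mod_cast this.1, by exact_mod_cast this.2⟩
  change _ = (Set.ncard {z : ι → ℤ | c z ∈ R} : ℝ)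
  rw [hset, Set.ncard_coe_finset, ← hfin _ (Finset.filter_subset _ _)]
  refine measureReal_congr ?_
  have hae : ∀ᵐ x ∂μ, x ∈ c '' Z := by
    rw [ae_iff]; exact hZ
  filter_upwards [hae] with x hx
  obtain ⟨z, hz, rfl⟩ := hx
  refine propext ⟨fun h => ⟨z, Finset.mem_coe.2 (Finset.mem_filter.2 ⟨hz, h⟩), rfl⟩, ?_⟩
  rintro ⟨w, hw, hwz⟩
  have := (Finset.mem_filter.1 (Finset.mem_coe.1 hw)).2
  rwa [hwz] at this

open Matrix

/-- The square of the Frobenius norm. -/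
def frobSq {n : ℕ} (M : Matrix (Fin n) (Fin n) ℝ) : ℝ := ∑ i, ∑ j, (M i j) ^ 2

/-- Some unit vector `u` satisfies `‖M u‖ ≤ ε ‖M‖_F`, i.e. the smallest singular value of `M` is
at most `ε` times the Frobenius norm. -/
def IllCond {n : ℕ} (ε : ℝ) (M : Matrix (Fin n) (Fin n) ℝ) : Prop :=
  ∃ u : Fin n → ℝ, u ⬝ᵥ u = 1 ∧ (M *ᵥ u) ⬝ᵥ (M *ᵥ u) ≤ ε ^ 2 * frobSq M

theorem frobSq_nonneg {n : ℕ} (M : Matrix (Fin n) (Fin n) ℝ) : 0 ≤ frobSq M :=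
  Finset.sum_nonneg fun _ _ => Finset.sum_nonneg fun _ _ => sq_nonneg _

theorem sq_apply_le_frobSq {n : ℕ} (M : Matrix (Fin n) (Fin n) ℝ) (i j : Fin n) :
    M i j ^ 2 ≤ frobSq M :=
  (Finset.single_le_sum (f := fun j => M i j ^ 2) (fun _ _ => sq_nonneg _)
    (Finset.mem_univ j)).trans
    (Finset.single_le_sum (f := fun i => ∑ j, M i j ^ 2)
      (fun _ _ => Finset.sum_nonneg fun _ _ => sq_nonneg _) (Finset.mem_univ i))

theorem frobSq_pos {n : ℕ} {M : Matrix (Fin n) (Fin n) ℝ} (hM : M ≠ 0) : 0 < frobSq M := by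
  by_contra h
  refine hM (Matrix.ext fun i j => ?_)
  exact pow_eq_zero_iff two_ne_zero |>.1
    (le_antisymm ((sq_apply_le_frobSq M i j).trans (not_lt.1 h)) (sq_nonneg _))

theorem frobInner_sq_le {n : ℕ} (A B : Matrix (Fin n) (Fin n) ℝ) :
    frobInner A B ^ 2 ≤ frobSq A * frobSq B := by
  simp only [frobInner, frobSq, ← Fintype.sum_prod_type']
  exact Finset.sum_mul_sq_le_sq_mul_sq _ _ _

theorem frobNorm_eq_sqrt {n : ℕ} (M : Matrix (Fin n) (Fin n) ℝ) : frobNorm M = √(frobSq M) := rfl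

theorem dFS_eq_sqrt {n : ℕ} (A B : Matrix (Fin n) (Fin n) ℝ) :
    dFS A B = √(1 - frobInner A B ^ 2 / (frobSq A * frobSq B)) := by
  rw [dFS, Real.sin_arccos, div_pow, sq_abs, mul_pow, frobNorm_eq_sqrt,
    frobNorm_eq_sqrt, Real.sq_sqrt (frobSq_nonneg A), Real.sq_sqrt (frobSq_nonneg B)]

theorem frobInner_vecMulVec {n : ℕ} (A : Matrix (Fin n) (Fin n) ℝ) (w u : Fin n → ℝ) :
    frobInner A (vecMulVec w u) = w ⬝ᵥ (A *ᵥ u) := by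
  simp only [frobInner, vecMulVec_apply, dotProduct, mulVec, Finset.mul_sum]
  exact Finset.sum_congr rfl fun i _ => Finset.sum_congr rfl fun j _ => by ring

theorem frobInner_sub_left {n : ℕ} (A B C : Matrix (Fin n) (Fin n) ℝ) :
    frobInner (A - B) C = frobInner A C - frobInner B C := by
  simp [frobInner, sub_mul, Finset.sum_sub_distrib]

theorem frobInner_comm {n : ℕ} (A B : Matrix (Fin n) (Fin n) ℝ) :
    frobInner A B = frobInner B A := by
  simp [frobInner, mul_comm]

theorem frobSq_eq_frobInner {n : ℕ} (A : Matrix (Fin n) (Fin n) ℝ) :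
    frobSq A = frobInner A A := by
  simp [frobInner, frobSq, sq]

theorem frobInner_self_sub_vecMulVec {n : ℕ} (M : Matrix (Fin n) (Fin n) ℝ) (u : Fin n → ℝ) :
    frobInner M (M - vecMulVec (M *ᵥ u) u) = frobSq M - (M *ᵥ u) ⬝ᵥ (M *ᵥ u) := by
  rw [frobInner_comm, frobInner_sub_left, ← frobSq_eq_frobInner, frobInner_comm,
    frobInner_vecMulVec]

theorem sub_vecMulVec_mulVec_eq_zero {n : ℕ} (M : Matrix (Fin n) (Fin n) ℝ) {u : Fin n → ℝ}
    (hu : u ⬝ᵥ u = 1) : (M - vecMulVec (M *ᵥ u) u) *ᵥ u = 0 := by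
  rw [sub_mulVec, vecMulVec_mulVec, hu]
  simp

theorem frobSq_sub_vecMulVec {n : ℕ} (M : Matrix (Fin n) (Fin n) ℝ) {u : Fin n → ℝ}
    (hu : u ⬝ᵥ u = 1) :
    frobSq (M - vecMulVec (M *ᵥ u) u) = frobSq M - (M *ᵥ u) ⬝ᵥ (M *ᵥ u) := by
  rw [frobSq_eq_frobInner, frobInner_sub_left, frobInner_self_sub_vecMulVec, frobInner_comm,
    frobInner_vecMulVec, sub_vecMulVec_mulVec_eq_zero M hu]
  simp

theorem dotProduct_self_pos {n : ℕ} {v : Fin n → ℝ} (hv : v ≠ 0) : 0 < v ⬝ᵥ v :=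
  lt_of_le_of_ne (Finset.sum_nonneg fun _ _ => mul_self_nonneg _)
    fun h => hv (dotProduct_self_eq_zero.1 h.symm)

theorem exists_unit_smul {n : ℕ} {v : Fin n → ℝ} (hv : v ≠ 0) :
    ∃ c : ℝ, (c • v) ⬝ᵥ (c • v) = 1 := by
  refine ⟨(√(v ⬝ᵥ v))⁻¹, ?_⟩
  have h := dotProduct_self_pos hv
  rw [smul_dotProduct, dotProduct_smul, smul_eq_mul, smul_eq_mul, ← mul_assoc, ← mul_inv,
    Real.mul_self_sqrt h.le, inv_mul_cancel₀ h.ne']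

theorem exists_unit_mulVec_eq_zero {n : ℕ} {S : Matrix (Fin n) (Fin n) ℝ} (hS : S.det = 0) :
    ∃ u : Fin n → ℝ, u ⬝ᵥ u = 1 ∧ S *ᵥ u = 0 := by
  obtain ⟨v, hv, hSv⟩ := exists_mulVec_eq_zero_iff.2 hS
  obtain ⟨c, hc⟩ := exists_unit_smul hv
  exact ⟨c • v, hc, by rw [mulVec_smul, hSv, smul_zero]⟩

theorem det_vecMulVec_eq_zero {n : ℕ} (hn : 2 ≤ n) (w u : Fin n → ℝ) :
    (vecMulVec w u).det = 0 := by
  by_contra h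
  have h1 := rank_of_isUnit (vecMulVec w u) ((isUnit_iff_isUnit_det _).2 (isUnit_iff_ne_zero.2 h))
  have h2 := rank_vecMulVec_le w u
  rw [h1, Fintype.card_fin] at h2
  omega

theorem isCompact_unit_vectors (n : ℕ) : IsCompact {u : Fin n → ℝ | u ⬝ᵥ u = 1} := by
  refine (isCompact_Icc (a := (-1 : Fin n → ℝ)) (b := 1)).of_isClosed_subset
    (isClosed_eq (by simp only [dotProduct]; fun_prop) continuous_const) fun u hu => ?_
  have h (i : Fin n) : |u i| ≤ 1 := by
    rw [← sq_le_one_iff_abs_le_one, sq]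
    have h1 : u i * u i ≤ u ⬝ᵥ u :=
      Finset.single_le_sum (f := fun i => u i * u i) (fun _ _ => mul_self_nonneg _)
        (Finset.mem_univ i)
    exact h1.trans hu.le
  exact ⟨fun i => (abs_le.1 (h i)).1, fun i => (abs_le.1 (h i)).2⟩

theorem rhoSing_le_iff {n : ℕ} (hn : 2 ≤ n) {ε : ℝ} (hε : 0 < ε) {M : Matrix (Fin n) (Fin n) ℝ}
    (hM : M ≠ 0) : rhoSing M ≤ ε ↔ IllCond ε M := by
  have hf := frobSq_pos hM
  constructor
  · intro hρ
    have hne : {u : Fin n → ℝ | u ⬝ᵥ u = 1}.Nonempty :=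
      ⟨Pi.single ⟨0, by omega⟩ 1, by simp⟩
    obtain ⟨u₀, hu₀, hmin⟩ := (isCompact_unit_vectors n).exists_isMinOn hne
      (f := fun u => (M *ᵥ u) ⬝ᵥ (M *ᵥ u))
      (Continuous.continuousOn (by simp only [dotProduct, mulVec]; fun_prop))
    refine ⟨u₀, hu₀, ?_⟩
    set m := (M *ᵥ u₀) ⬝ᵥ (M *ᵥ u₀)
    have hle : √(m / frobSq M) ≤ rhoSing M := by
      refine le_csInf ?_ ?_
      · refine ⟨_, vecMulVec (Pi.single ⟨0, by omega⟩ 1) (Pi.single ⟨0, by omega⟩ 1), ?_, ?_, rfl⟩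
        · intro h
          have := congrFun (congrFun h ⟨0, by omega⟩) ⟨0, by omega⟩
          simp [vecMulVec_apply] at this
        · rw [det_vecMulVec_eq_zero hn]; simp
      · rintro t ⟨S, hS, hdet, rfl⟩
        obtain ⟨u, hu, hSu⟩ := exists_unit_mulVec_eq_zero (by simpa using hdet)
        have hg := frobSq_pos hS
        have hmu : m ≤ (M *ᵥ u) ⬝ᵥ (M *ᵥ u) := hmin hu
        have hcs : frobInner M S ^ 2 ≤ (frobSq M - (M *ᵥ u) ⬝ᵥ (M *ᵥ u)) * frobSq S := by
          rw [← frobSq_sub_vecMulVec M hu]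
          refine le_of_eq_of_le ?_ (frobInner_sq_le _ _)
          rw [frobInner_sub_left, frobInner_comm (vecMulVec _ _), frobInner_vecMulVec, hSu]
          simp
        rw [dFS_eq_sqrt]
        refine Real.sqrt_le_sqrt ?_
        rw [le_sub_iff_add_le, div_add_div _ _ hf.ne' (mul_pos hf hg).ne', div_le_one (by positivity)]
        nlinarith [mul_le_mul_of_nonneg_right hmu hg.le]
    have h2 := (Real.sqrt_le_left hε.le).1 (hle.trans hρ)
    rwa [div_le_iff₀ hf] at h2
  · rintro ⟨u, hu, hle⟩
    have bound {S : Matrix (Fin n) (Fin n) ℝ} (hS : S ≠ 0) (hdet : S.det = 0)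
        (hd : dFS M S ≤ ε) : rhoSing M ≤ ε := by
      have hmem : dFS M S ∈ {t : ℝ | ∃ S : Matrix (Fin n) (Fin n) ℝ,
          S ≠ 0 ∧ ¬ IsUnit S.det ∧ t = dFS M S} := ⟨S, hS, by simp [hdet], rfl⟩
      refine (csInf_le ⟨0, ?_⟩ hmem).trans hd
      rintro t ⟨S, -, -, rfl⟩
      rw [dFS_eq_sqrt]
      exact Real.sqrt_nonneg _
    by_cases hS : M - vecMulVec (M *ᵥ u) u = 0
    · refine bound hM ?_ ?_
      · rw [sub_eq_zero.1 hS]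
        exact det_vecMulVec_eq_zero hn _ _
      · rw [dFS_eq_sqrt, ← frobSq_eq_frobInner, ← sq, div_self (by positivity)]
        simpa using hε.le
    · refine bound hS (exists_mulVec_eq_zero_iff.1
        ⟨u, ?_, sub_vecMulVec_mulVec_eq_zero M hu⟩) ?_
      · rintro rfl
        simp at hu
      · have hg := frobSq_pos hS
        rw [frobSq_sub_vecMulVec M hu] at hg
        rw [dFS_eq_sqrt, frobInner_self_sub_vecMulVec, frobSq_sub_vecMulVec M hu,
          Real.sqrt_le_left hε.le]
        have : 1 - (frobSq M - M *ᵥ u ⬝ᵥ M *ᵥ u) ^ 2 / (frobSq M * (frobSq M - M *ᵥ u ⬝ᵥ M *ᵥ u)) =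
            (M *ᵥ u ⬝ᵥ M *ᵥ u) / frobSq M := by
          field_simp
          ring
        rw [this, div_le_iff₀ hf]
        exact hle

theorem IllCond.zero {n : ℕ} (hn : 2 ≤ n) (ε : ℝ) :
    IllCond ε (0 : Matrix (Fin n) (Fin n) ℝ) :=
  ⟨Pi.single ⟨0, by omega⟩ 1, by simp, by rw [zero_mulVec]; simp [frobSq]⟩

theorem mem_Rset_iff {n : ℕ} (hn : 2 ≤ n) {ε H : ℝ} (hε : 0 < ε) (hH : 0 ≤ H)
    {M : Matrix (Fin n) (Fin n) ℝ} : M ∈ Rset n ε H ↔ frobSq M ≤ H ^ 2 ∧ IllCond ε M := by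
  have h1 : frobNorm M ≤ H ↔ frobSq M ≤ H ^ 2 := Real.sqrt_le_left hH
  have h2 : (M = 0 ∨ rhoSing M ≤ ε) ↔ IllCond ε M := by
    by_cases hM : M = 0
    · subst hM
      simp [IllCond.zero hn ε]
    · simp [hM, rhoSing_le_iff hn hε hM]
  exact and_congr h1 h2

theorem frobSq_smul {n : ℕ} (c : ℝ) (M : Matrix (Fin n) (Fin n) ℝ) :
    frobSq (c • M) = c ^ 2 * frobSq M := by
  simp [frobSq, mul_pow, Finset.mul_sum]

theorem IllCond.smul_iff {n : ℕ} {ε c : ℝ} (hc : c ≠ 0) {M : Matrix (Fin n) (Fin n) ℝ} :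
    IllCond ε (c • M) ↔ IllCond ε M := by
  refine exists_congr fun u => and_congr_right fun _ => ?_
  rw [smul_mulVec, smul_dotProduct, dotProduct_smul, frobSq_smul, smul_eq_mul, smul_eq_mul,
    ← mul_assoc, ← sq, mul_left_comm, mul_le_mul_iff_right₀ (by positivity)]

theorem smul_mem_Rset_iff {n : ℕ} (hn : 2 ≤ n) {ε H c : ℝ} (hε : 0 < ε) (hH : 0 ≤ H)
    (hc : 0 < c) {M : Matrix (Fin n) (Fin n) ℝ} :
    c • M ∈ Rset n ε H ↔ M ∈ Rset n ε (H / c) := by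
  rw [mem_Rset_iff hn hε hH, mem_Rset_iff hn hε (by positivity), IllCond.smul_iff hc.ne',
    frobSq_smul, div_pow, le_div_iff₀ (by positivity), mul_comm]

theorem isClosed_illCond (n : ℕ) (ε : ℝ) :
    IsClosed {M : Matrix (Fin n) (Fin n) ℝ | IllCond ε M} := by
  let K := {u : Fin n → ℝ | u ⬝ᵥ u = 1}
  have : CompactSpace K := isCompact_iff_compactSpace.1 (isCompact_unit_vectors n)
  have hcl : IsClosed {q : Matrix (Fin n) (Fin n) ℝ × K |
      (q.1 *ᵥ q.2) ⬝ᵥ (q.1 *ᵥ q.2) ≤ ε ^ 2 * frobSq q.1} := by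
    have h : Continuous fun q : Matrix (Fin n) (Fin n) ℝ × K => q.1 *ᵥ (q.2 : Fin n → ℝ) :=
      continuous_fst.matrix_mulVec (continuous_subtype_val.comp continuous_snd)
    exact isClosed_le (h.dotProduct h) (by simp only [frobSq]; fun_prop)
  convert isClosedMap_fst_of_compactSpace _ hcl
  ext M
  simp [IllCond, K]

theorem continuous_frobSq (n : ℕ) : Continuous (frobSq (n := n)) := by
  unfold frobSq; fun_prop

theorem isClosed_Rset {n : ℕ} (hn : 2 ≤ n) {ε H : ℝ} (hε : 0 < ε) (hH : 0 ≤ H) :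
    IsClosed (Rset n ε H) := by
  have : Rset n ε H = {M | frobSq M ≤ H ^ 2} ∩ {M | IllCond ε M} := by
    ext M
    exact mem_Rset_iff hn hε hH
  rw [this]
  exact (isClosed_le (continuous_frobSq n) continuous_const).inter (isClosed_illCond n ε)

/-- The matrix `MᵀM - ε²‖M‖_F² I`, which is positive definite exactly when `M` fails to be
`IllCond ε`. -/
def gramShift {R : Type*} [CommRing R] {n : ℕ} (c : R) (M : Matrix (Fin n) (Fin n) R) :
    Matrix (Fin n) (Fin n) R :=
  Mᵀ * M - (c * ∑ i, ∑ j, (M i j) ^ 2) • 1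

theorem gramShift_apply {R : Type*} [CommRing R] {n : ℕ} (c : R) (M : Matrix (Fin n) (Fin n) R)
    (i j : Fin n) : gramShift c M i j =
      ∑ k, M k i * M k j - if i = j then c * ∑ i, ∑ j, (M i j) ^ 2 else 0 := by
  simp [gramShift, mul_apply, one_apply]

theorem dotProduct_gramShift_mulVec {n : ℕ} (c : ℝ) (M : Matrix (Fin n) (Fin n) ℝ)
    (u : Fin n → ℝ) : u ⬝ᵥ (gramShift c M *ᵥ u) =
      (M *ᵥ u) ⬝ᵥ (M *ᵥ u) - c * frobSq M * (u ⬝ᵥ u) := by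
  rw [gramShift, sub_mulVec, dotProduct_sub, ← mulVec_mulVec, dotProduct_mulVec, vecMul_transpose,
    smul_mulVec, one_mulVec, dotProduct_smul]
  rfl

theorem illCond_of_det_gramShift_eq_zero {n : ℕ} {ε : ℝ} {M : Matrix (Fin n) (Fin n) ℝ}
    (h : (gramShift (ε ^ 2) M).det = 0) : IllCond ε M := by
  obtain ⟨u, hu, hMu⟩ := exists_unit_mulVec_eq_zero h
  refine ⟨u, hu, ?_⟩
  have h1 := dotProduct_gramShift_mulVec (ε ^ 2) M u
  rw [hMu, dotProduct_zero, hu] at h1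
  linarith

theorem IllCond.exists_lt {n : ℕ} {ε : ℝ} {M : Matrix (Fin n) (Fin n) ℝ} (hM : IllCond ε M)
    (h : (gramShift (ε ^ 2) M).det ≠ 0) :
    ∃ u : Fin n → ℝ, u ⬝ᵥ u = 1 ∧ (M *ᵥ u) ⬝ᵥ (M *ᵥ u) < ε ^ 2 * frobSq M := by
  by_contra! hcon
  have hpsd : (gramShift (ε ^ 2) M).PosSemidef := by
    refine .of_dotProduct_mulVec_nonneg ?_ fun v => ?_
    · simp [gramShift, IsHermitian, conjTranspose_eq_transpose_of_trivial]
    · rw [star_trivial]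
      by_cases hv : v = 0
      · simp [hv]
      · obtain ⟨c, hc⟩ := exists_unit_smul hv
        have h1 := dotProduct_gramShift_mulVec (ε ^ 2) M (c • v)
        have h2 := hcon _ hc
        rw [hc, mulVec_smul, smul_dotProduct, dotProduct_smul, smul_eq_mul, smul_eq_mul,
          ← mul_assoc] at h1
        have hc0 : c ≠ 0 := by
          rintro rfl
          simp at hc
        have hcc : 0 < c * c := mul_self_pos.2 hc0
        exact nonneg_of_mul_nonneg_right (by linarith) hcc
  obtain ⟨u, hu, hle⟩ := hM
  have hu0 : u ≠ 0 := by
    rintro rfl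
    simp at hu
  have h1 := (hpsd.posDef_iff_det_ne_zero.2 h).dotProduct_mulVec_pos hu0
  rw [star_trivial, dotProduct_gramShift_mulVec, hu] at h1
  linarith

theorem natDegree_det_le_of_le {n d : ℕ} (A : Matrix (Fin n) (Fin n) (Polynomial ℝ))
    (hA : ∀ i j, (A i j).natDegree ≤ d) : A.det.natDegree ≤ n * d := by
  rw [det_apply]
  refine Polynomial.natDegree_sum_le_of_forall_le _ _ fun σ _ => ?_
  refine (Polynomial.natDegree_smul_le _ _).trans ((Polynomial.natDegree_prod_le _ _).trans ?_)
  exact (Finset.sum_le_sum fun i _ => hA _ _).trans (by simp)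

theorem exists_finset_frontier_line {n : ℕ} (hn : 2 ≤ n) {ε H : ℝ} (hε : 0 < ε) (hH : 0 ≤ H)
    (x : Fin n × Fin n → ℝ) (p : Fin n × Fin n) :
    ∃ F : Finset ℝ, frontier {s : ℝ | (of fun i j => Function.update x p s (i, j)) ∈ Rset n ε H} ⊆ F
      ∧ F.card ≤ 2 * n + 2 := by
  classical
  set g : ℝ → Matrix (Fin n) (Fin n) ℝ := fun s => of fun i j => Function.update x p s (i, j)
  have hg : Continuous g := by
    refine continuous_matrix fun i j => ?_
    have hu : Continuous fun s : ℝ => Function.update x p s :=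
      continuous_const.update p continuous_id
    exact (continuous_apply (i, j)).comp hu
  let P : Matrix (Fin n) (Fin n) (Polynomial ℝ) :=
    of fun i j => if (i, j) = p then Polynomial.X else Polynomial.C (x (i, j))
  have hPeval (s : ℝ) : P.map (Polynomial.evalRingHom s) = g s := by
    ext i j
    simp only [P, g, map_apply, of_apply, Function.update_apply]
    split_ifs <;> simp
  have hPdeg (i j) : (P i j).natDegree ≤ 1 := by
    simp only [P, of_apply]
    split_ifs <;> simp
  let f : Polynomial ℝ := ∑ i, ∑ j, P i j ^ 2
  have hfdeg : f.natDegree ≤ 2 :=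
    Polynomial.natDegree_sum_le_of_forall_le _ _ fun i _ =>
      Polynomial.natDegree_sum_le_of_forall_le _ _ fun j _ =>
        Polynomial.natDegree_pow_le_of_le 2 (hPdeg i j)
  have hfeval (s : ℝ) : f.eval s = frobSq (g s) := by
    rw [← hPeval s]
    simp [f, frobSq, Polynomial.eval_finsetSum]
  let D : Polynomial ℝ := (gramShift (Polynomial.C (ε ^ 2)) P).det
  have hDdeg : D.natDegree ≤ n * 2 := by
    refine natDegree_det_le_of_le _ fun i j => ?_
    rw [gramShift_apply]
    refine (Polynomial.natDegree_sub_le _ _).trans (max_le ?_ ?_)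
    · exact Polynomial.natDegree_sum_le_of_forall_le _ _ fun k _ =>
        Polynomial.natDegree_mul_le_of_le (hPdeg k i) (hPdeg k j)
    · split_ifs
      · exact (Polynomial.natDegree_C_mul_le _ _).trans hfdeg
      · simp
  have hDeval (s : ℝ) : D.eval s = (gramShift (ε ^ 2) (g s)).det := by
    rw [← hPeval s, ← Polynomial.coe_evalRingHom, RingHom.map_det]
    congr 1
    ext i j
    rw [RingHom.mapMatrix_apply, map_apply, gramShift_apply, gramShift_apply]
    split_ifs <;> simp [Polynomial.eval_finsetSum]
  have hf0 : f - Polynomial.C (H ^ 2) ≠ 0 := by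
    intro h0
    have h1 : f.eval (H + 1) = H ^ 2 := by rw [sub_eq_zero.1 h0]; simp
    rw [hfeval] at h1
    have h2 := sq_apply_le_frobSq (g (H + 1)) p.1 p.2
    simp only [g, of_apply, Prod.mk.eta, Function.update_self] at h1 h2
    nlinarith
  refine ⟨(f - Polynomial.C (H ^ 2)).roots.toFinset ∪ D.roots.toFinset, ?_, ?_⟩
  · intro s hs
    have hcl : IsClosed {s : ℝ | g s ∈ Rset n ε H} := (isClosed_Rset hn hε hH).preimage hg
    rw [hcl.frontier_eq] at hs
    obtain ⟨hsU, hsI⟩ := hs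
    obtain ⟨hsH, hsC⟩ := (mem_Rset_iff hn hε hH).1 hsU
    by_contra hF
    simp only [Finset.coe_union, Set.mem_union, Finset.mem_coe, Multiset.mem_toFinset, not_or,
      Polynomial.mem_roots', not_and] at hF
    have hlt : frobSq (g s) < H ^ 2 := by
      refine lt_of_le_of_ne hsH fun h => hF.1 hf0 ?_
      simp [Polynomial.IsRoot, hfeval, h]
    have hball : IsOpen {s : ℝ | frobSq (g s) < H ^ 2} :=
      isOpen_lt ((continuous_frobSq n).comp hg) continuous_const
    refine hsI ?_
    by_cases hD : D = 0
    · refine mem_interior.2 ⟨_, fun r hr => ?_, hball, hlt⟩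
      refine (mem_Rset_iff hn hε hH).2 ⟨le_of_lt hr, illCond_of_det_gramShift_eq_zero ?_⟩
      rw [← hDeval, hD, Polynomial.eval_zero]
    · obtain ⟨u, hu, hult⟩ := hsC.exists_lt (by rw [← hDeval]; exact hF.2 hD)
      have hopen : IsOpen {s : ℝ | (g s *ᵥ u) ⬝ᵥ (g s *ᵥ u) < ε ^ 2 * frobSq (g s)} := by
        refine isOpen_lt ?_ (((continuous_frobSq n).comp hg).const_mul _)
        have := hg.matrix_mulVec (continuous_const (y := u))
        exact this.dotProduct this
      refine mem_interior.2 ⟨_, fun r hr => ?_, hball.inter hopen, hlt, hult⟩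
      exact (mem_Rset_iff hn hε hH).2 ⟨le_of_lt hr.1, u, hu, le_of_lt hr.2⟩
  · refine (Finset.card_union_le _ _).trans ?_
    have h1 : (f - Polynomial.C (H ^ 2)).roots.toFinset.card ≤ 2 :=
      (Multiset.toFinset_card_le _).trans ((Polynomial.card_roots' _).trans
        (by rw [Polynomial.natDegree_sub_C]; exact hfdeg))
    have h2 : D.roots.toFinset.card ≤ n * 2 :=
      (Multiset.toFinset_card_le _).trans ((Polynomial.card_roots' _).trans hDdeg)
    omega

/-- `Rset` in the coordinates indexed by pairs of indices. -/
def pairRset (n : ℕ) (ε H : ℝ) : Set (Fin n × Fin n → ℝ) :=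
  {x | (of fun i j => x (i, j)) ∈ Rset n ε H}

theorem measurableSet_pairRset {n : ℕ} (hn : 2 ≤ n) {ε H : ℝ} (hε : 0 < ε) (hH : 0 ≤ H) :
    MeasurableSet (pairRset n ε H) := by
  refine IsClosed.measurableSet ((isClosed_Rset hn hε hH).preimage ?_)
  exact continuous_matrix fun i j => continuous_apply (i, j)

theorem abs_apply_le_of_mem_Rset {n : ℕ} (hn : 2 ≤ n) {ε H : ℝ} (hε : 0 < ε) (hH : 0 ≤ H)
    {M : Matrix (Fin n) (Fin n) ℝ} (hM : M ∈ Rset n ε H) (i j : Fin n) : |M i j| ≤ H :=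
  abs_le_of_sq_le_sq ((sq_apply_le_frobSq M i j).trans ((mem_Rset_iff hn hε hH).1 hM).1) hH

theorem measurePreserving_curry_real (ι κ : Type*) [Fintype ι] [Fintype κ] :
    MeasurePreserving (MeasurableEquiv.curry ι κ ℝ) := by
  refine MeasurePreserving.symm (MeasurableEquiv.curry ι κ ℝ).symm
    ⟨(MeasurableEquiv.curry ι κ ℝ).symm.measurable, (Measure.pi_eq fun s _ => ?_).symm⟩
  have : (MeasurableEquiv.curry ι κ ℝ).symm ⁻¹' Set.univ.pi s =
      Set.univ.pi fun i => Set.univ.pi fun j => s (i, j) := by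
    ext x
    simp [Set.mem_pi, Prod.forall]
  rw [MeasurableEquiv.map_apply, this, volume_pi_pi, Fintype.prod_prod_type]
  simp only [volume_pi_pi]

theorem volume_pairRset (n : ℕ) (ε H : ℝ) : volume (pairRset n ε H) = volume (Rset n ε H) :=
  (measurePreserving_curry_real (Fin n) (Fin n)).measure_preimage_equiv (Rset n ε H)

theorem volume_Rset_div {n : ℕ} (hn : 2 ≤ n) {ε H c : ℝ} (hε : 0 < ε) (hH : 0 ≤ H) (hc : 0 < c) :
    (volume (Rset n ε (H / c))).toReal = (volume (Rset n ε H)).toReal / c ^ (n ^ 2) := by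
  have h : pairRset n ε (H / c) = (c • ·) ⁻¹' pairRset n ε H := by
    ext x
    exact (smul_mem_Rset_iff hn hε hH hc).symm
  rw [← volume_pairRset, ← volume_pairRset, h, Measure.addHaar_preimage_smul _ hc.ne',
    ENNReal.toReal_mul, ENNReal.toReal_ofReal (abs_nonneg _), abs_of_pos (by positivity)]
  simp only [Module.finrank_fintype_fun_eq_card, Fintype.card_prod, Fintype.card_fin, ← sq]
  rw [div_eq_inv_mul]

theorem volume_Rset_one_le {n : ℕ} (hn : 2 ≤ n) {ε : ℝ} (hε : 0 < ε) :
    (volume (Rset n ε 1)).toReal ≤ 2 ^ (n ^ 2) := by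
  rw [← volume_pairRset]
  refine ENNReal.toReal_le_of_le_ofReal (by positivity) ?_
  calc volume (pairRset n ε 1)
      ≤ volume (Set.univ.pi fun _ : Fin n × Fin n => Set.Icc (-1 : ℝ) 1) := by
        refine measure_mono fun x hx i _ => abs_le.1 ?_
        exact abs_apply_le_of_mem_Rset hn hε zero_le_one hx i.1 i.2
    _ = ENNReal.ofReal (2 ^ (n ^ 2)) := by
        rw [volume_pi_pi]
        norm_num [Real.volume_Icc, ← sq, ENNReal.ofReal_pow]

theorem finite_intMatrix_mem_Rset {n : ℕ} (hn : 2 ≤ n) {ε H : ℝ} (hε : 0 < ε) (hH : 0 ≤ H) :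
    {A : Matrix (Fin n) (Fin n) ℤ | A.map (Int.cast : ℤ → ℝ) ∈ Rset n ε H}.Finite := by
  have hfin : (Set.Icc (fun _ _ => -⌊H⌋ : Fin n → Fin n → ℤ) (fun _ _ => ⌊H⌋)).Finite :=
    Set.finite_Icc _ _
  refine Set.Finite.subset hfin fun A hA => ?_
  have h (i j : Fin n) : |A i j| ≤ ⌊H⌋ := by
    refine Int.le_floor.2 ?_
    have : |((A i j : ℤ) : ℝ)| ≤ H := abs_apply_le_of_mem_Rset hn hε hH hA i j
    simpa using this
  exact ⟨fun i j => (abs_le.1 (h i j)).1, fun i j => (abs_le.1 (h i j)).2⟩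

theorem abs_ncard_sub_volume_Rset_le {n : ℕ} (hn : 2 ≤ n) {ε H : ℝ} (hε : 0 < ε) (hH : 0 ≤ H)
    {T : ℕ} (hT : H ≤ T) :
    |(Set.ncard {A : Matrix (Fin n) (Fin n) ℤ | A.map (Int.cast : ℤ → ℝ) ∈ Rset n ε H} : ℝ) -
        (volume (Rset n ε H)).toReal| ≤
      n ^ 2 * (2 * n + 2) * (2 * T + 1) ^ (n ^ 2 - 1) := by
  set lam : Measure ℝ := volume.restrict (Set.Icc (-T : ℝ) T)
  have hbox {x : Fin n × Fin n → ℝ} (hx : x ∈ pairRset n ε H) (i) : |x i| ≤ T :=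
    (abs_apply_le_of_mem_Rset hn hε hH hx i.1 i.2).trans hT
  have hR := measurableSet_pairRset hn hε hH
  have hlam : lam.real Set.univ ≤ 2 * T + 1 := by
    simp only [lam, measureReal_restrict_apply_univ, Real.volume_real_Icc]
    exact max_le (by linarith) (by positivity)
  have key := abs_measureReal_pi_sub_le (h := 2 * n + 2) (intMeasure T) lam
    (intMeasure_real_univ T).le hlam (by positivity) hR fun x p => ?_
  · have hcount : (Measure.pi fun _ : Fin n × Fin n => intMeasure T).real (pairRset n ε H) =
        Set.ncard {A : Matrix (Fin n) (Fin n) ℤ | A.map (Int.cast : ℤ → ℝ) ∈ Rset n ε H} := by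
      rw [pi_intMeasure_real T fun x hx i => hbox hx i,
        ← Set.ncard_image_of_injective _ (Equiv.curry (Fin n) (Fin n) ℤ).injective,
        Equiv.image_eq_preimage_symm]
      rfl
    have hvol : (Measure.pi fun _ : Fin n × Fin n => lam).real (pairRset n ε H) =
        (volume (Rset n ε H)).toReal := by
      have hsub : pairRset n ε H ⊆ Set.univ.pi fun _ => Set.Icc (-T : ℝ) T :=
        fun x hx i _ => abs_le.1 (hbox hx i)
      rw [← volume_pairRset, ← Measure.restrict_pi_pi, Measure.real, Measure.restrict_apply hR,
        Set.inter_eq_left.2 hsub, volume_pi]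
    rw [hcount, hvol] at key
    simpa [← sq] using key
  · obtain ⟨F, hF, hcard⟩ := exists_finset_frontier_line hn hε hH x p
    refine (abs_intMeasure_sub_volume_le T ?_ ?_ F hF).trans (by exact_mod_cast hcard)
    · exact (measurable_update x) hR
    · intro s hs
      have := hbox hs p
      rw [Function.update_self] at this
      exact abs_le.1 this

/-- The number of nonzero integer matrices in `Rset n ε H`. -/
def latCount (n : ℕ) (ε H : ℝ) : ℕ :=
  Set.ncard {A : Matrix (Fin n) (Fin n) ℤ | A ≠ 0 ∧ A.map (Int.cast : ℤ → ℝ) ∈ Rset n ε H}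

theorem one_le_frobSq_intMatrix {n : ℕ} {A : Matrix (Fin n) (Fin n) ℤ} (hA : A ≠ 0) :
    1 ≤ frobSq (A.map (Int.cast : ℤ → ℝ)) := by
  obtain ⟨i, j, hij⟩ : ∃ i j, A i j ≠ 0 := by
    by_contra! h
    exact hA (Matrix.ext h)
  refine le_trans ?_ (sq_apply_le_frobSq _ i j)
  have : 1 ≤ A i j ^ 2 := by
    have := Int.one_le_abs hij
    nlinarith [sq_abs (A i j)]
  rw [map_apply]
  exact_mod_cast this

theorem latCount_eq_zero {n : ℕ} (hn : 2 ≤ n) {ε H : ℝ} (hε : 0 < ε) (hH : 0 ≤ H) (hH1 : H < 1) :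
    latCount n ε H = 0 := by
  have : {A : Matrix (Fin n) (Fin n) ℤ | A ≠ 0 ∧ A.map (Int.cast : ℤ → ℝ) ∈ Rset n ε H} = ∅ := by
    refine Set.eq_empty_of_forall_notMem fun A ⟨hA, hAR⟩ => ?_
    have h1 := one_le_frobSq_intMatrix hA
    have h2 := ((mem_Rset_iff hn hε hH).1 hAR).1
    nlinarith
  rw [latCount, this, Set.ncard_empty]

theorem abs_latCount_sub_volume_le {n : ℕ} (hn : 2 ≤ n) {ε H : ℝ} (hε : 0 < ε) (hH : 0 < H) :
    |(latCount n ε H : ℝ) - (volume (Rset n ε H)).toReal| ≤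
      (n ^ 2 * (2 * n + 2) * 5 ^ (n ^ 2 - 1) + 1 + 2 ^ (n ^ 2)) * H ^ (n ^ 2 - 1) := by
  rcases lt_or_ge H 1 with h1 | h1
  · rw [latCount_eq_zero hn hε hH.le h1]
    have hV := volume_Rset_div hn hε zero_le_one (c := 1 / H) (by positivity)
    rw [one_div_one_div, div_pow, one_pow, div_div_eq_mul_div, div_one] at hV
    rw [hV, Nat.cast_zero, zero_sub, abs_neg, abs_of_nonneg (by positivity)]
    calc (volume (Rset n ε 1)).toReal * H ^ (n ^ 2)
        ≤ 2 ^ (n ^ 2) * H ^ (n ^ 2 - 1) := by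
          exact mul_le_mul (volume_Rset_one_le hn hε)
            (pow_le_pow_of_le_one hH.le h1.le (Nat.sub_le _ _)) (by positivity) (by positivity)
      _ ≤ _ := by
          gcongr
          have : (0 : ℝ) ≤ n ^ 2 * (2 * n + 2) * 5 ^ (n ^ 2 - 1) := by positivity
          linarith
  · have hT : (⌈H⌉₊ : ℝ) ≤ 2 * H := (Nat.ceil_lt_add_one hH.le).le.trans (by linarith)
    have h2 := abs_ncard_sub_volume_Rset_le hn hε hH.le (Nat.le_ceil H)
    have h3 : latCount n ε H + 1 =
        Set.ncard {A : Matrix (Fin n) (Fin n) ℤ | A.map (Int.cast : ℤ → ℝ) ∈ Rset n ε H} := by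
      rw [← Set.ncard_sdiff_singleton_add_one (a := 0) ?_ (finite_intMatrix_mem_Rset hn hε hH.le)]
      · rw [latCount]
        congr 2
        ext A
        simp [and_comm]
      · rw [Set.mem_ofPred_eq, mem_Rset_iff hn hε hH.le]
        simpa [frobSq, sq_nonneg] using IllCond.zero hn ε
    rw [← h3] at h2
    push_cast at h2
    have h4 : (n ^ 2 * (2 * n + 2) * (2 * ⌈H⌉₊ + 1) ^ (n ^ 2 - 1) : ℝ) ≤
        n ^ 2 * (2 * n + 2) * 5 ^ (n ^ 2 - 1) * H ^ (n ^ 2 - 1) := by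
      rw [mul_assoc _ (5 ^ _ : ℝ), ← mul_pow]
      gcongr
      linarith
    have h5 : 1 ≤ H ^ (n ^ 2 - 1) := one_le_pow₀ h1
    have h6 : (0 : ℝ) ≤ 2 ^ (n ^ 2) * H ^ (n ^ 2 - 1) := by positivity
    rw [abs_le] at h2 ⊢
    constructor <;> linarith [h2.1, h2.2]

/-- The primitive integer matrices in `Rset n ε H`. -/
def primSet (n : ℕ) (ε H : ℝ) : Set (Matrix (Fin n) (Fin n) ℤ) :=
  {A | Finset.univ.gcd (fun p : Fin n × Fin n => A p.1 p.2) = 1 ∧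
    A.map (Int.cast : ℤ → ℝ) ∈ Rset n ε H}

theorem ne_zero_of_gcd_eq_one {n : ℕ} {A : Matrix (Fin n) (Fin n) ℤ}
    (hA : Finset.univ.gcd (fun p : Fin n × Fin n => A p.1 p.2) = 1) : A ≠ 0 := by
  rintro rfl
  have : Finset.univ.gcd (fun p : Fin n × Fin n => (0 : Matrix (Fin n) (Fin n) ℤ) p.1 p.2) = 0 :=
    Finset.gcd_eq_zero_iff.2 fun _ _ => rfl
  omega

theorem map_intCast_ne_zero {R : Type*} [Ring R] [CharZero R] {n : ℕ}
    {A : Matrix (Fin n) (Fin n) ℤ} (hA : A ≠ 0) : A.map (Int.cast : ℤ → R) ≠ 0 := by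
  intro h
  refine hA (Matrix.ext fun i j => ?_)
  have := congrFun (congrFun h i) j
  simpa using this

theorem card_filter_dvd_eq_latCount {n : ℕ} (hn : 2 ≤ n) {ε H : ℝ} (hε : 0 < ε) (hH : 0 ≤ H)
    {k : ℕ} (hk : 0 < k) :
    Set.ncard {A : Matrix (Fin n) (Fin n) ℤ | (A ≠ 0 ∧ A.map (Int.cast : ℤ → ℝ) ∈ Rset n ε H) ∧
      (k : ℤ) ∣ Finset.univ.gcd (fun p : Fin n × Fin n => A p.1 p.2)} = latCount n ε (H / k) := by
  have hk' : (k : ℤ) ≠ 0 := by exact_mod_cast hk.ne'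
  have hinj : Function.Injective fun B : Matrix (Fin n) (Fin n) ℤ => (k : ℤ) • B :=
    smul_right_injective _ hk'
  have hmap (B : Matrix (Fin n) (Fin n) ℤ) : ((k : ℤ) • B).map (Int.cast : ℤ → ℝ) =
      (k : ℝ) • B.map (Int.cast : ℤ → ℝ) := by
    ext i j
    simp only [map_apply, Matrix.smul_apply, smul_eq_mul]
    push_cast
    rfl
  rw [latCount, ← Set.ncard_image_of_injective
    {A | A ≠ 0 ∧ A.map (Int.cast : ℤ → ℝ) ∈ Rset n ε (H / k)} hinj]
  congr 1
  ext A
  constructor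
  · rintro ⟨⟨hA, hAR⟩, hdvd⟩
    rw [Finset.dvd_gcd_iff] at hdvd
    choose b hb using fun i j => hdvd (i, j) (Finset.mem_univ _)
    have hAB : (k : ℤ) • (of b : Matrix (Fin n) (Fin n) ℤ) = A := by
      ext i j
      simpa using (hb i j).symm
    refine ⟨of b, ⟨?_, ?_⟩, hAB⟩
    · intro h
      rw [h, smul_zero] at hAB
      exact hA hAB.symm
    · rwa [← smul_mem_Rset_iff hn hε hH (by exact_mod_cast hk), ← hmap, hAB]
  · rintro ⟨B, ⟨hB, hBR⟩, rfl⟩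
    refine ⟨⟨smul_ne_zero hk' hB, ?_⟩, Finset.dvd_gcd fun p _ => ⟨B p.1 p.2, by simp⟩⟩
    rwa [hmap, smul_mem_Rset_iff hn hε hH (by exact_mod_cast hk)]

open ArithmeticFunction in
theorem ncard_primSet_eq_sum {n : ℕ} (hn : 2 ≤ n) {ε H : ℝ} (hε : 0 < ε) (hH : 0 ≤ H)
    {K : ℕ} (hK : H ≤ K) :
    ((primSet n ε H).ncard : ℝ) =
      ∑ k ∈ Finset.range K, (moebius (k + 1) : ℝ) * latCount n ε (H / (k + 1)) := by
  classical
  set c : Matrix (Fin n) (Fin n) ℤ → ℤ := fun A =>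
    Finset.univ.gcd (fun p : Fin n × Fin n => A p.1 p.2)
  have hfin : {A : Matrix (Fin n) (Fin n) ℤ |
      A ≠ 0 ∧ A.map (Int.cast : ℤ → ℝ) ∈ Rset n ε H}.Finite :=
    (finite_intMatrix_mem_Rset hn hε hH).subset fun A hA => hA.2
  set Z := hfin.toFinset
  have hZ (A) : A ∈ Z ↔ A ≠ 0 ∧ A.map (Int.cast : ℤ → ℝ) ∈ Rset n ε H := by simp [Z]
  have hprim : primSet n ε H = (Z.filter fun A => (c A).natAbs = 1 : Finset _) := by
    ext A
    have hnorm : (c A).natAbs = 1 ↔ c A = 1 := by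
      have : 0 ≤ c A :=
        abs_eq_self.1 (by rw [Int.abs_eq_normalize]; exact Finset.normalize_gcd)
      omega
    simp only [Finset.coe_filter, Set.mem_ofPred_eq, hZ, hnorm]
    exact ⟨fun h => ⟨⟨ne_zero_of_gcd_eq_one h.1, h.2⟩, h.1⟩, fun h => ⟨h.2, h.1.2⟩⟩
  have hcount (k : ℕ) (hk : 0 < k) :
      ((Z.filter fun A => k ∣ (c A).natAbs).card : ℝ) = latCount n ε (H / k) := by
    rw [← card_filter_dvd_eq_latCount hn hε hH hk, ← Set.ncard_coe_finset]
    congr 2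
    ext A
    simp only [Finset.coe_filter, Set.mem_ofPred_eq, hZ, Int.natCast_dvd, c]
  have hdiv (A) (hA : A ∈ Z) : (if (c A).natAbs = 1 then 1 else 0 : ℝ) =
      ∑ k ∈ Finset.Ico 1 (K + 1), if k ∣ (c A).natAbs then (moebius k : ℝ) else 0 := by
    obtain ⟨hA0, hAR⟩ := (hZ A).1 hA
    obtain ⟨i, j, hij⟩ : ∃ i j, A i j ≠ 0 := by
      by_contra! h
      exact hA0 (Matrix.ext h)
    have hdvd : c A ∣ A i j := Finset.gcd_dvd (f := fun p : Fin n × Fin n => A p.1 p.2)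
      (Finset.mem_univ (i, j))
    have hc0 : (c A).natAbs ≠ 0 := by
      intro h
      rw [Int.natAbs_eq_zero.1 h, zero_dvd_iff] at hdvd
      exact hij hdvd
    have hcK : (c A).natAbs ≤ K := by
      refine (Nat.le_of_dvd (Int.natAbs_pos.2 hij) (Int.natAbs_dvd_natAbs.2 hdvd)).trans ?_
      have := (abs_apply_le_of_mem_Rset hn hε hH hAR i j).trans hK
      rw [map_apply] at this
      have h2 : |A i j| ≤ (K : ℤ) := by exact_mod_cast this
      rw [Int.abs_eq_natAbs] at h2
      omega
    have hdivs : (Finset.Ico 1 (K + 1)).filter (· ∣ (c A).natAbs) = (c A).natAbs.divisors := by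
      ext k
      simp only [Finset.mem_filter, Finset.mem_Ico, Nat.mem_divisors]
      refine ⟨fun h => ⟨h.2, hc0⟩, fun h => ⟨⟨Nat.pos_of_dvd_of_pos h.1 (by omega), ?_⟩, h.1⟩⟩
      have := Nat.le_of_dvd (by omega) h.1
      omega
    rw [← Finset.sum_filter, hdivs, ← Int.cast_sum, ← coe_mul_zeta_apply, moebius_mul_coe_zeta,
      ArithmeticFunction.one_apply]
    split_ifs <;> simp
  calc ((primSet n ε H).ncard : ℝ)
      = ∑ A ∈ Z, if (c A).natAbs = 1 then 1 else 0 := by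
        rw [hprim, Set.ncard_coe_finset]; simp
    _ = ∑ A ∈ Z, ∑ k ∈ Finset.Ico 1 (K + 1),
          if k ∣ (c A).natAbs then (moebius k : ℝ) else 0 := Finset.sum_congr rfl hdiv
    _ = ∑ k ∈ Finset.Ico 1 (K + 1), (moebius k : ℝ) * latCount n ε (H / k) := by
        rw [Finset.sum_comm]
        refine Finset.sum_congr rfl fun k hk => ?_
        rw [← hcount k (Finset.mem_Ico.1 hk).1, ← Finset.sum_filter, Finset.sum_const,
          nsmul_eq_mul, mul_comm]
    _ = _ := by
        rw [Finset.sum_Ico_eq_sum_range]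
        refine Finset.sum_congr (by simp) fun k _ => ?_
        rw [add_comm 1 k]
        push_cast
        rfl

theorem eq_or_eq_neg_of_mk_eq {n : ℕ} {A B : Matrix (Fin n) (Fin n) ℤ}
    (hA : Finset.univ.gcd (fun p : Fin n × Fin n => A p.1 p.2) = 1)
    (hB : Finset.univ.gcd (fun p : Fin n × Fin n => B p.1 p.2) = 1)
    (hA0 : A.map (Int.cast : ℤ → ℚ) ≠ 0) (hB0 : B.map (Int.cast : ℤ → ℚ) ≠ 0)
    (h : Projectivization.mk ℚ _ hA0 = Projectivization.mk ℚ _ hB0) : A = B ∨ A = -B := by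
  obtain ⟨q, hq⟩ := (Projectivization.mk_eq_mk_iff' ℚ _ _ hA0 hB0).1 h
  have hentry (p : Fin n × Fin n) : q.num * B p.1 p.2 = q.den * A p.1 p.2 := by
    have h1 : q * (B p.1 p.2 : ℚ) = A p.1 p.2 := congrFun (congrFun hq p.1) p.2
    have h2 : (q.den : ℚ) ≠ 0 := by exact_mod_cast q.den_ne_zero
    have h3 : (q.num : ℚ) * B p.1 p.2 = q.den * A p.1 p.2 := by
      rw [← h1, ← mul_assoc, Rat.den_mul_eq_num]
    exact_mod_cast h3
  have hnorm : normalize q.num = normalize (q.den : ℤ) := by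
    rw [← mul_one (normalize q.num), ← mul_one (normalize (q.den : ℤ))]
    nth_rewrite 1 [← hB]
    rw [← hA, ← Finset.gcd_mul_left, ← Finset.gcd_mul_left]
    simp only [hentry]
  have hden : (q.den : ℤ) ≠ 0 := by exact_mod_cast q.den_ne_zero
  have habs : q.num = q.den ∨ q.num = -q.den := by
    rw [← Int.natAbs_eq_natAbs_iff]
    exact Int.associated_iff_natAbs.1 (normalize_eq_normalize_iff_associated.1 hnorm)
  refine habs.imp (fun hq => ?_) (fun hq => ?_) <;> ext i j <;> have := hentry (i, j) <;>
    rw [hq] at this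
  · exact (mul_left_cancel₀ hden this).symm
  · rw [neg_mul_comm] at this
    exact (mul_left_cancel₀ hden this).symm

theorem memShat_mk_iff {n : ℕ} (hn : 2 ≤ n) {ε : ℝ} (hε : 0 < ε)
    {A : Matrix (Fin n) (Fin n) ℤ} (hA : A.map (Int.cast : ℤ → ℚ) ≠ 0) :
    memShat (Projectivization.mk ℚ _ hA) ε ↔ IllCond ε (A.map (Int.cast : ℤ → ℝ)) := by
  obtain ⟨q, hq⟩ := Projectivization.exists_smul_eq_mk_rep ℚ _ hA
  have hrep : (Projectivization.mk ℚ _ hA).rep.map (Rat.cast : ℚ → ℝ) =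
      ((q : ℚ) : ℝ) • A.map (Int.cast : ℤ → ℝ) := by
    rw [← hq]
    ext i j
    simp [Units.smul_def]
  have hq0 : ((q : ℚ) : ℝ) ≠ 0 := by exact_mod_cast q.ne_zero
  have hA0 : A.map (Int.cast : ℤ → ℝ) ≠ 0 := by
    refine map_intCast_ne_zero ?_
    rintro rfl
    exact hA (by ext; simp)
  rw [memShat, hrep, rhoSing_le_iff hn hε (smul_ne_zero hq0 hA0), IllCond.smul_iff hq0]

theorem gcd_neg_eq {n : ℕ} (A : Matrix (Fin n) (Fin n) ℤ) :
    Finset.univ.gcd (fun p : Fin n × Fin n => (-A) p.1 p.2) =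
      Finset.univ.gcd (fun p : Fin n × Fin n => A p.1 p.2) := by
  have := Finset.gcd_mul_left (s := Finset.univ) (f := fun p : Fin n × Fin n => A p.1 p.2) (a := -1)
  simpa [← Int.abs_eq_normalize] using this

theorem neg_mem_primSet {n : ℕ} (hn : 2 ≤ n) {ε H : ℝ} (hε : 0 < ε) (hH : 0 ≤ H)
    {A : Matrix (Fin n) (Fin n) ℤ} (hA : A ∈ primSet n ε H) : -A ∈ primSet n ε H := by
  refine ⟨(gcd_neg_eq A).trans hA.1, ?_⟩
  have hmap : (-A).map (Int.cast : ℤ → ℝ) = (-1 : ℝ) • A.map (Int.cast : ℤ → ℝ) := by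
    ext; simp
  have h := (mem_Rset_iff hn hε hH).1 hA.2
  rw [mem_Rset_iff hn hε hH, hmap, frobSq_smul, IllCond.smul_iff (by norm_num)]
  simpa using h

theorem two_mul_ncard_eq_ncard_primSet {n : ℕ} (hn : 2 ≤ n) {ε H : ℝ} (hε : 0 < ε) (hH : 0 ≤ H) :
    2 * Set.ncard {P : Projectivization ℚ (Matrix (Fin n) (Fin n) ℚ) |
      heightLE P H ∧ memShat P ε} = (primSet n ε H).ncard := by
  set S := {P : Projectivization ℚ (Matrix (Fin n) (Fin n) ℚ) | heightLE P H ∧ memShat P ε}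
  have hfin : (primSet n ε H).Finite :=
    (finite_intMatrix_mem_Rset hn hε hH).subset fun A hA => hA.2
  have hfrob (A : Matrix (Fin n) (Fin n) ℤ) : frobNorm (A.map (Int.cast : ℤ → ℝ)) ≤ H ↔
      frobSq (A.map (Int.cast : ℤ → ℝ)) ≤ H ^ 2 := Real.sqrt_le_left hH
  have hex (P) : ∃ A : Matrix (Fin n) (Fin n) ℤ, P ∈ S → A ∈ primSet n ε H ∧
      ∃ h0 : A.map (Int.cast : ℤ → ℚ) ≠ 0, P = Projectivization.mk ℚ _ h0 := by
    by_cases hP : P ∈ S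
    · obtain ⟨⟨A, h0, hgcd, rfl, hle⟩, hmem⟩ := hP
      refine ⟨A, fun _ => ⟨⟨hgcd, ?_⟩, h0, rfl⟩⟩
      exact (mem_Rset_iff hn hε hH).2 ⟨(hfrob A).1 hle, (memShat_mk_iff hn hε h0).1 hmem⟩
    · exact ⟨0, fun h => absurd h hP⟩
  choose g hg using hex
  have hinj : Set.InjOn g S := fun P hP Q hQ h => by
    obtain ⟨_, h1, hP'⟩ := hg P hP
    obtain ⟨_, h2, hQ'⟩ := hg Q hQ
    rw [hP', hQ']
    simp only [h]
  have hunion : primSet n ε H = g '' S ∪ (fun P => -g P) '' S := by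
    refine Set.Subset.antisymm (fun A hA => ?_) ?_
    · have h0 : A.map (Int.cast : ℤ → ℚ) ≠ 0 := map_intCast_ne_zero (ne_zero_of_gcd_eq_one hA.1)
      have hR := (mem_Rset_iff hn hε hH).1 hA.2
      have hS : Projectivization.mk ℚ _ h0 ∈ S :=
        ⟨⟨A, h0, hA.1, rfl, (hfrob A).2 hR.1⟩, (memShat_mk_iff hn hε h0).2 hR.2⟩
      obtain ⟨hp, h0', hmk⟩ := hg _ hS
      exact (eq_or_eq_neg_of_mk_eq hA.1 hp.1 h0 h0' hmk).imp
        (fun h => ⟨_, hS, h.symm⟩) (fun h => ⟨_, hS, h.symm⟩)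
    · rintro _ (⟨P, hP, rfl⟩ | ⟨P, hP, rfl⟩)
      · exact (hg P hP).1
      · exact neg_mem_primSet hn hε hH (hg P hP).1
  have hdisj : Disjoint (g '' S) ((fun P => -g P) '' S) := by
    refine Set.disjoint_left.2 ?_
    rintro _ ⟨P, hP, rfl⟩ ⟨Q, hQ, hPQ⟩
    obtain ⟨hp, h1, hP'⟩ := hg P hP
    obtain ⟨_, h2, hQ'⟩ := hg Q hQ
    have : P = Q := by
      rw [hP', hQ', Projectivization.mk_eq_mk_iff']
      refine ⟨-1, ?_⟩
      rw [← hPQ]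
      ext
      simp
    subst this
    refine ne_zero_of_gcd_eq_one hp.1 (Matrix.ext fun i j => ?_)
    have : -g P i j = g P i j := congrFun (congrFun hPQ i) j
    rw [Matrix.zero_apply]
    omega
  rw [hunion, Set.ncard_union_eq hdisj (hfin.subset (hunion ▸ Set.subset_union_left))
    (hfin.subset (hunion ▸ Set.subset_union_right)), hinj.ncard_image,
    Set.InjOn.ncard_image fun P hP Q hQ h => hinj hP hQ (neg_injective h), two_mul]

theorem summable_one_div_add_one_pow {m : ℕ} (hm : 2 ≤ m) :
    Summable fun k : ℕ => 1 / ((k : ℝ) + 1) ^ m := by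
  have := (summable_nat_add_iff 1).2 (Real.summable_one_div_nat_pow.2 hm)
  simpa using this

theorem one_le_zetaN {m : ℕ} (hm : 2 ≤ m) : 1 ≤ zetaN m := by
  have := (summable_one_div_add_one_pow hm).le_tsum 0 fun k _ => by positivity
  simpa [zetaN] using this

theorem zetaN_le_two {m : ℕ} (hm : 2 ≤ m) : zetaN m ≤ 2 := by
  have h2 : zetaN 2 = Real.pi ^ 2 / 6 := by
    rw [← hasSum_zeta_two.tsum_eq, hasSum_zeta_two.summable.tsum_eq_zero_add]
    simp [zetaN]
  have hle : zetaN m ≤ zetaN 2 := by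
    refine (summable_one_div_add_one_pow hm).tsum_le_tsum (fun k => ?_)
      (summable_one_div_add_one_pow le_rfl)
    gcongr
    simp
  nlinarith [Real.pi_lt_d2, Real.pi_pos]

open ArithmeticFunction in
theorem hasSum_moebius_div_pow {m : ℕ} (hm : 2 ≤ m) :
    HasSum (fun k : ℕ => (moebius (k + 1) : ℝ) / ((k : ℝ) + 1) ^ m) (zetaN m)⁻¹ := by
  have hs : 1 < ((m : ℂ)).re := by
    rw [Complex.natCast_re]
    exact_mod_cast hm
  have hzeta : riemannZeta m = (zetaN m : ℂ) := by
    rw [zeta_eq_tsum_one_div_nat_add_one_cpow hs, zetaN, Complex.ofReal_tsum]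
    simp
  have hmul := LSeries_zeta_mul_Lseries_moebius hs
  rw [LSeries_zeta_eq_riemannZeta hs, hzeta] at hmul
  have hL := (LSeriesSummable_moebius_iff.2 hs).LSeriesHasSum
  rw [eq_inv_of_mul_eq_one_right hmul, LSeriesHasSum, ← hasSum_nat_add_iff' 1] at hL
  rw [← Complex.hasSum_ofReal]
  have hterm : (fun k : ℕ => (((moebius (k + 1) : ℝ) / ((k : ℝ) + 1) ^ m : ℝ) : ℂ)) =
      fun k => LSeries.term (fun n => (moebius n : ℂ)) m (k + 1) := by
    ext k
    simp
  rw [hterm]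
  simpa using hL

theorem Kvol_nonneg (l : ℕ) : 0 ≤ Kvol l :=
  div_nonneg (by positivity) (Real.Gamma_pos_of_pos (by positivity)).le

theorem one_le_Sfrak {m : ℕ} (hm : 0 < m) : 1 ≤ Sfrak m := by
  have h := Finset.single_le_sum (f := fun l => (m.choose l : ℝ) * Kvol l)
    (fun l _ => mul_nonneg (Nat.cast_nonneg _) (Kvol_nonneg l)) (Finset.mem_range.2 hm)
  simpa [Kvol, Sfrak] using h

theorem four_mul_le_Tconst {n : ℕ} (hn : 2 ≤ n) :
    4 * (n ^ 2 * (2 * n + 2) * 5 ^ (n ^ 2 - 1) + 1 + 2 ^ (n ^ 2) : ℝ) ≤ Tconst n := by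
  set b := 2 * max 4 n with hb
  have h8 : 8 ≤ b := by omega
  have hbn : n + 1 ≤ b := by omega
  have hbn2 : 2 * n + 2 ≤ b * b := by nlinarith
  have h1 : n ^ 2 * (2 * n + 2) * 5 ^ (n ^ 2 - 1) ≤ b ^ 2 * b ^ 2 * b ^ (n ^ 2) := by
    have hn' : n ≤ b := by omega
    have h5 : 5 ^ (n ^ 2 - 1) ≤ b ^ (n ^ 2) :=
      (Nat.pow_le_pow_left (by omega) _).trans (Nat.pow_le_pow_right (by omega) (by omega))
    rw [← sq] at hbn2
    gcongr
  have h2 : 2 ^ (n ^ 2) ≤ b ^ (n ^ 2) := Nat.pow_le_pow_left (by omega) _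
  have h3 : 1 ≤ b ^ (n ^ 2) := Nat.one_le_pow _ _ (by omega)
  have h4 : 1 ≤ b ^ 4 := Nat.one_le_pow _ _ (by omega)
  have key : 4 * (n ^ 2 * (2 * n + 2) * 5 ^ (n ^ 2 - 1) + 1 + 2 ^ (n ^ 2)) ≤
      b ^ (2 * n ^ 4 + 4 * n ^ 2) :=
    calc 4 * (n ^ 2 * (2 * n + 2) * 5 ^ (n ^ 2 - 1) + 1 + 2 ^ (n ^ 2))
        ≤ 12 * (b ^ 4 * b ^ (n ^ 2)) := by nlinarith
      _ ≤ b ^ 2 * (b ^ 4 * b ^ (n ^ 2)) := Nat.mul_le_mul_right _ (by nlinarith)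
      _ = b ^ (6 + n ^ 2) := by rw [← pow_add, ← pow_add]; congr 1; omega
      _ ≤ b ^ (2 * n ^ 4 + 4 * n ^ 2) := Nat.pow_le_pow_right (by omega) (by nlinarith)
  rw [Tconst]
  exact_mod_cast key

open ArithmeticFunction in
theorem abs_ncard_primSet_sub_le {n : ℕ} (hn : 2 ≤ n) {ε H : ℝ} (hε : 0 < ε) (hH : 0 < H) :
    |((primSet n ε H).ncard : ℝ) - (volume (Rset n ε H)).toReal / zetaN (n ^ 2)| ≤
      (n ^ 2 * (2 * n + 2) * 5 ^ (n ^ 2 - 1) + 1 + 2 ^ (n ^ 2)) * H ^ (n ^ 2 - 1) *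
        zetaN (n ^ 2 - 1) := by
  have hn4 : 4 ≤ n ^ 2 := by nlinarith
  set C : ℝ := n ^ 2 * (2 * n + 2) * 5 ^ (n ^ 2 - 1) + 1 + 2 ^ (n ^ 2)
  have hcount : HasSum (fun k : ℕ => (moebius (k + 1) : ℝ) * latCount n ε (H / (k + 1)))
      (primSet n ε H).ncard := by
    rw [ncard_primSet_eq_sum hn hε hH.le (Nat.le_ceil H)]
    refine hasSum_sum_of_ne_finset_zero fun k hk => ?_
    have hk' : (⌈H⌉₊ : ℝ) ≤ k := by exact_mod_cast not_lt.1 (mt Finset.mem_range.2 hk)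
    have hlt : H < k + 1 := by linarith [Nat.le_ceil H]
    rw [latCount_eq_zero hn hε (by positivity) ((div_lt_one (by positivity)).2 hlt),
      Nat.cast_zero, mul_zero]
  have hvol := (hasSum_moebius_div_pow (m := n ^ 2) (by omega)).mul_left
    (volume (Rset n ε H)).toReal
  have hbound := ((summable_one_div_add_one_pow (m := n ^ 2 - 1) (by omega)).hasSum).mul_left
    (C * H ^ (n ^ 2 - 1))
  have hdiff := hcount.sub hvol
  rw [← div_eq_mul_inv] at hdiff
  rw [← hdiff.tsum_eq, ← Real.norm_eq_abs]
  refine tsum_of_norm_bounded hbound fun k => ?_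
  have hk : (0 : ℝ) < k + 1 := by positivity
  have hle := abs_latCount_sub_volume_le hn hε (div_pos hH hk)
  rw [volume_Rset_div hn hε hH.le hk, div_pow] at hle
  have hmu : |(moebius (k + 1) : ℝ)| ≤ 1 := by exact_mod_cast abs_moebius_le_one
  calc ‖(moebius (k + 1) : ℝ) * latCount n ε (H / (k + 1)) -
          (volume (Rset n ε H)).toReal * ((moebius (k + 1) : ℝ) / ((k : ℝ) + 1) ^ n ^ 2)‖
      = |(moebius (k + 1) : ℝ)| * |(latCount n ε (H / (k + 1)) : ℝ) -
          (volume (Rset n ε H)).toReal / ((k : ℝ) + 1) ^ n ^ 2| := by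
        rw [← abs_mul, Real.norm_eq_abs]
        ring_nf
    _ ≤ 1 * (C * (H ^ (n ^ 2 - 1) / ((k : ℝ) + 1) ^ (n ^ 2 - 1))) := by gcongr
    _ = _ := by ring

/-- `|𝒩(ε,H) − Vol(R(ε,H))/(2ζ(n²))| ≤ L(ε,n)·H^{n²−1} + H/2` where
`L(ε,n) := T_n·𝔖^{(n²)}/(2ζ(n²−1)) + Vol(R(ε,1))/2`. -/
theorem ill_conditioned_rational_points_count
    {n : ℕ} (hn : 2 ≤ n) (H ε : ℝ) (hH : 1 ≤ H) (hε : 0 < ε) :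
    |(Set.ncard {P : Projectivization ℚ (Matrix (Fin n) (Fin n) ℚ) |
          heightLE P H ∧ memShat P ε} : ℝ) -
        (volume (Rset n ε H)).toReal / (2 * zetaN (n ^ 2))| ≤
      (Tconst n * Sfrak (n ^ 2) / (2 * zetaN (n ^ 2 - 1)) +
          (volume (Rset n ε 1)).toReal / 2) * H ^ (n ^ 2 - 1) + H / 2 := by
  have hn4 : 4 ≤ n ^ 2 := by nlinarith
  have hmain := abs_ncard_primSet_sub_le hn hε (zero_lt_one.trans_le hH)
  rw [← two_mul_ncard_eq_ncard_primSet hn hε (zero_le_one.trans hH)] at hmain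
  set S := {P : Projectivization ℚ (Matrix (Fin n) (Fin n) ℚ) | heightLE P H ∧ memShat P ε}
  set C : ℝ := n ^ 2 * (2 * n + 2) * 5 ^ (n ^ 2 - 1) + 1 + 2 ^ (n ^ 2)
  set V := (volume (Rset n ε H)).toReal
  set z := zetaN (n ^ 2 - 1)
  have hz1 : 1 ≤ z := one_le_zetaN (by omega)
  have hz2 : z ≤ 2 := zetaN_le_two (by omega)
  have hC : C * z ≤ Tconst n * Sfrak (n ^ 2) / z := by
    have hC0 : 0 ≤ C := by positivity
    rw [le_div_iff₀ (by linarith), mul_assoc]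
    calc C * (z * z) ≤ C * (2 * 2) := by gcongr
      _ = 4 * C := by ring
      _ ≤ Tconst n := four_mul_le_Tconst hn
      _ ≤ Tconst n * Sfrak (n ^ 2) :=
        le_mul_of_one_le_right (by rw [Tconst]; positivity) (one_le_Sfrak (by omega))
  have hsplit : (S.ncard : ℝ) - V / (2 * zetaN (n ^ 2)) =
      (((2 * S.ncard : ℕ) : ℝ) - V / zetaN (n ^ 2)) / 2 := by
    push_cast
    ring
  have hpow : 0 ≤ H ^ (n ^ 2 - 1) := by positivity
  rw [hsplit, abs_div, abs_two]
  calc |((2 * S.ncard : ℕ) : ℝ) - V / zetaN (n ^ 2)| / 2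
      ≤ C * z * H ^ (n ^ 2 - 1) / 2 := by linarith
    _ ≤ Tconst n * Sfrak (n ^ 2) / z * H ^ (n ^ 2 - 1) / 2 := by gcongr
    _ = Tconst n * Sfrak (n ^ 2) / (2 * z) * H ^ (n ^ 2 - 1) := by ring
    _ ≤ (Tconst n * Sfrak (n ^ 2) / (2 * z) + (volume (Rset n ε 1)).toReal / 2) *
          H ^ (n ^ 2 - 1) := by
        gcongr
        linarith [ENNReal.toReal_nonneg (a := volume (Rset n ε 1))]
    _ ≤ _ := by linarith

end
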